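/- For every integer r ≥ 6, let G = G_{r,r⁴} be the graph on n = 2r + 2r⁴ vertices obtained by taking a complete graph K_r, a path v₁ − ⋯ − v_r, and a complete bipartite graph K_{r⁴,r⁴}, joining one vertex of K_r to v₁ and joining v_r to one vertex of K_{r⁴,r⁴}. Then G and its complement Ḡ are both connected, and Gap(G) + Gap(Ḡ) ≤ 8/r³ < 2/√n. (In particular, the conjectured inequality Gap(G) + Gap(Ḡ) ≥ 2/√n for graphs with connected complement is false.) -/

import Mathlib

open Classical in
/-- Transition matrix of the simple random walk on `G`:
`P v w = 1/deg(v)` if `v ~ w`, else `0`. -/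
noncomputable def transitionMatrix {V : Type*} [Fintype V] (G : SimpleGraph V) :
    Matrix V V ℝ :=
  fun v w => if G.Adj v w then ((G.degree v : ℝ))⁻¹ else 0

/-- The second-largest eigenvalue of a matrix with real spectrum: the second-largest
root (with multiplicity) of its characteristic polynomial. -/
noncomputable def lambda2 {V : Type*} [Fintype V] [DecidableEq V] (M : Matrix V V ℝ) : ℝ :=
  (M.charpoly.roots.sort (· ≤ ·)).getD ((M.charpoly.roots.sort (· ≤ ·)).length - 2) 0

open Classical in
/-- Spectral gap of the random walk on `G`; by convention `0` if some vertex is isolated. -/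
noncomputable def spectralGap {V : Type*} [Fintype V] (G : SimpleGraph V) : ℝ :=
  if ∀ v, 0 < G.degree v then 1 - lambda2 (transitionMatrix G) else 0

/-- Base relation generating the graph `G_{r,m}`: a clique `K_r`, a path
`v₁ - ⋯ - v_r`, an edge from a vertex of `K_r` to `v₁`, an edge from `v_r` to a
vertex `v` of `K_{m,m}`, and the complete bipartite graph `K_{m,m}`. -/
def lollipopRel (r m : ℕ) :
    ((Fin r ⊕ Fin r) ⊕ (Fin m ⊕ Fin m)) → ((Fin r ⊕ Fin r) ⊕ (Fin m ⊕ Fin m)) → Prop :=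
  fun x y =>
    match x, y with
    | Sum.inl (Sum.inl _), Sum.inl (Sum.inl _) => True            -- clique K_r
    | Sum.inl (Sum.inr i), Sum.inl (Sum.inr j) => i.val + 1 = j.val -- path v₁-⋯-v_r
    | Sum.inl (Sum.inl a), Sum.inl (Sum.inr i) => a.val = 0 ∧ i.val = 0 -- K_r to v₁
    | Sum.inl (Sum.inr i), Sum.inr (Sum.inl b) => i.val = r - 1 ∧ b.val = 0 -- v_r to v
    | Sum.inr (Sum.inl _), Sum.inr (Sum.inr _) => True            -- K_{m,m}
    | _, _ => False

/-- The graph `G_{r,m}`: `K_{m,m}` with an attached lollipop `L_{r,r}`. -/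
def lollipop (r m : ℕ) : SimpleGraph ((Fin r ⊕ Fin r) ⊕ (Fin m ⊕ Fin m)) :=
  SimpleGraph.fromRel (lollipopRel r m)

open Matrix Finset in
theorem exists_forall_ne_lt_of_sort_getD_lt {ι : Type*} [Fintype ι] [Nonempty ι] (μ : ι → ℝ)
    (c : ℝ) (h : ((univ.val.map μ).sort (· ≤ ·)).getD
      (((univ.val.map μ).sort (· ≤ ·)).length - 2) 0 < c) :
    ∃ i₀, ∀ i, i ≠ i₀ → μ i < c := by
  classical
  set l := (univ.val.map μ).sort (· ≤ ·) with hl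
  have hcoe : (l : Multiset ℝ) = univ.val.map μ := Multiset.sort_eq _ _
  have hsorted : l.Pairwise (· ≤ ·) := Multiset.pairwise_sort _ _
  have hlen : 0 < l.length := by
    rw [hl, Multiset.length_sort]; simp [Fintype.card_pos]
  have htake : (l.take (l.length - 1)).countP (fun x => decide (c ≤ x)) = 0 := by
    rw [List.countP_eq_zero]
    intro x hx
    obtain ⟨k, hk, rfl⟩ := List.mem_iff_getElem.mp hx
    rw [List.length_take] at hk
    rw [List.getD_eq_getElem (hn := by omega)] at h
    rw [List.getElem_take]
    simpa using (hsorted.rel_get_of_le (a := ⟨k, by omega⟩) (b := ⟨l.length - 2, by omega⟩)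
      (by simp; omega)).trans_lt h
  have hcount : l.countP (fun x => decide (c ≤ x)) ≤ 1 := by
    rw [← List.take_append_drop (l.length - 1) l, List.countP_append, htake, zero_add]
    refine List.countP_le_length.trans ?_
    rw [List.length_drop]; omega
  have hcard : (univ.filter fun i => c ≤ μ i).card ≤ 1 := by
    have : (l : Multiset ℝ).countP (fun x => c ≤ x) ≤ 1 := by
      simpa [Multiset.coe_countP] using hcount
    rw [hcoe, Multiset.countP_map] at this
    exact this
  by_cases hne : ∃ i, c ≤ μ i
  · obtain ⟨i₀, hi₀⟩ := hne
    refine ⟨i₀, fun i hi => ?_⟩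
    by_contra! hc
    exact hi (card_le_one.mp hcard i (by simpa using hc) i₀ (by simpa using hi₀))
  · push Not at hne
    exact ⟨Classical.arbitrary ι, fun i _ => hne i⟩

open Matrix in
theorem Matrix.IsHermitian.dotProduct_mulVec_eq_sum_eigenvalues {V : Type*} [Fintype V]
    [DecidableEq V] {S : Matrix V V ℝ} (hS : S.IsHermitian) (z : V → ℝ) :
    z ⬝ᵥ S *ᵥ z = ∑ i, hS.eigenvalues i * ((hS.eigenvectorBasis i).ofLp ⬝ᵥ z) ^ 2 := by
  have h := hS.eigenvectorBasis.sum_inner_mul_inner (WithLp.toLp 2 z) (WithLp.toLp 2 (S *ᵥ z))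
  simp only [EuclideanSpace.inner_eq_star_dotProduct, star_trivial] at h
  rw [dotProduct_comm, ← h]
  refine Finset.sum_congr rfl fun i _ => ?_
  have hT : S.IsSymm := by simpa using hS
  have : (S *ᵥ z) ⬝ᵥ (hS.eigenvectorBasis i).ofLp
      = hS.eigenvalues i * ((hS.eigenvectorBasis i).ofLp ⬝ᵥ z) := by
    rw [dotProduct_comm, dotProduct_mulVec, ← mulVec_transpose, hT.eq, hS.mulVec_eigenvectorBasis,
      smul_dotProduct, smul_eq_mul]
  rw [this]; ring

open Matrix in
theorem Matrix.IsHermitian.dotProduct_self_eq_sum {V : Type*} [Fintype V]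
    [DecidableEq V] {S : Matrix V V ℝ} (hS : S.IsHermitian) (z : V → ℝ) :
    z ⬝ᵥ z = ∑ i, ((hS.eigenvectorBasis i).ofLp ⬝ᵥ z) ^ 2 := by
  have h := hS.eigenvectorBasis.sum_inner_mul_inner (WithLp.toLp 2 z) (WithLp.toLp 2 z)
  simp only [EuclideanSpace.inner_eq_star_dotProduct, star_trivial] at h
  rw [← h]
  refine Finset.sum_congr rfl fun i _ => ?_
  rw [dotProduct_comm z]; ring

open Matrix in
/-- Courant-Fischer lower bound on the second eigenvalue by a two-dimensional test space. -/
theorem le_lambda2_of_isHermitian {V : Type*} [Fintype V] [DecidableEq V] [Nonempty V]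
    {S : Matrix V V ℝ} (hS : S.IsHermitian) (c : ℝ) (x y : V → ℝ)
    (hxy : ∀ a b : ℝ, a • x + b • y = 0 → a = 0 ∧ b = 0)
    (hq : ∀ a b : ℝ, c * ((a • x + b • y) ⬝ᵥ (a • x + b • y)) ≤
      (a • x + b • y) ⬝ᵥ S *ᵥ (a • x + b • y)) :
    c ≤ lambda2 S := by
  by_contra! hlt
  rw [lambda2, hS.roots_charpoly_eq_eigenvalues] at hlt
  obtain ⟨i₀, hi₀⟩ := exists_forall_ne_lt_of_sort_getD_lt _ c hlt
  simp only [Function.comp_apply, RCLike.ofReal_real_eq_id, id_eq] at hi₀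
  have key : ∀ a b : ℝ, (hS.eigenvectorBasis i₀).ofLp ⬝ᵥ (a • x + b • y) = 0 →
      a = 0 ∧ b = 0 := by
    intro a b h0
    refine hxy a b ?_
    have h := hq a b
    set z := a • x + b • y
    rw [hS.dotProduct_mulVec_eq_sum_eigenvalues, hS.dotProduct_self_eq_sum,
      Finset.mul_sum] at h
    rw [← dotProduct_self_eq_zero, hS.dotProduct_self_eq_sum]
    refine Finset.sum_eq_zero fun i _ => ?_
    by_cases hi : i = i₀
    · rw [hi, h0]; simp
    have hle : ∀ j ∈ Finset.univ,
        hS.eigenvalues j * ((hS.eigenvectorBasis j).ofLp ⬝ᵥ z) ^ 2 ≤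
          c * ((hS.eigenvectorBasis j).ofLp ⬝ᵥ z) ^ 2 := by
      intro j _
      by_cases hj : j = i₀
      · rw [hj, h0]; simp
      · exact mul_le_mul_of_nonneg_right (hi₀ j hj).le (sq_nonneg _)
    have heq := (Finset.sum_eq_sum_iff_of_le hle).mp
      (le_antisymm (Finset.sum_le_sum hle) h) i (Finset.mem_univ i)
    have := hi₀ i hi
    by_contra hne
    exact this.ne (mul_right_cancel₀ hne heq)
  have h1 := key ((hS.eigenvectorBasis i₀).ofLp ⬝ᵥ y) (-((hS.eigenvectorBasis i₀).ofLp ⬝ᵥ x))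
    (by simp [dotProduct_add, dotProduct_smul]; ring)
  have h2 := key 1 0 (by simpa [dotProduct_add, dotProduct_smul] using h1.2)
  exact one_ne_zero h2.1

open Classical in
/-- Dirichlet energy of `f`, every edge being counted once in each direction. -/
noncomputable def dirichletEnergy {V : Type*} [Fintype V] (G : SimpleGraph V) (f : V → ℝ) : ℝ :=
  ∑ v, ∑ w, if G.Adj v w then (f v - f w) ^ 2 else 0

open Classical in
/-- Squared norm of `f`, weighted by the degrees of `G`. -/
noncomputable def degreeNormSq {V : Type*} [Fintype V] (G : SimpleGraph V) (f : V → ℝ) : ℝ :=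
  ∑ v, (G.degree v : ℝ) * f v ^ 2

open Matrix Classical in
theorem spectralGap_le_of_dirichlet {V : Type*} [Fintype V] [Nonempty V] (G : SimpleGraph V)
    (f : V → ℝ) (ε : ℝ) (hε : 0 ≤ ε) (hf : ∃ v w, f v ≠ f w)
    (hE : ∀ a : ℝ, dirichletEnergy G f ≤ 2 * ε * degreeNormSq G fun v => a + f v) :
    spectralGap G ≤ ε := by
  simp only [dirichletEnergy, degreeNormSq] at hE
  unfold spectralGap
  split_ifs with hdeg
  swap
  · exact hε
  have hd : ∀ v, (0 : ℝ) < G.degree v := fun v => by exact_mod_cast hdeg v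
  set s : V → ℝ := fun v => Real.sqrt (G.degree v) with hs
  have hs0 : ∀ v, s v ≠ 0 := fun v => (Real.sqrt_pos.mpr (hd v)).ne'
  have hss : ∀ v, s v * s v = G.degree v := fun v => Real.mul_self_sqrt (hd v).le
  set S : Matrix V V ℝ := diagonal s⁻¹ * G.adjMatrix ℝ * diagonal s⁻¹ with hSdef
  have hS : S.IsHermitian := by
    ext v w
    simp only [hSdef, conjTranspose_apply, star_trivial, diagonal_mul, mul_diagonal,
      SimpleGraph.adjMatrix_apply, G.adj_comm w v]
    ring
  have hP : transitionMatrix G = diagonal s⁻¹ * (diagonal s⁻¹ * G.adjMatrix ℝ) := by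
    ext v w
    simp only [diagonal_mul, SimpleGraph.adjMatrix_apply, transitionMatrix, Pi.inv_apply]
    split_ifs
    · rw [← hss v, mul_inv, mul_one]
    · simp
  have hl : lambda2 (transitionMatrix G) = lambda2 S := by
    rw [lambda2, lambda2, hP, charpoly_mul_comm]
  rw [hl]
  have hcomb : ∀ a b : ℝ, a • s + b • (s * f) = s * (fun v => a + b * f v) := by
    intro a b; ext v; simp; ring
  have := le_lambda2_of_isHermitian hS (1 - ε) s (s * f) ?_ ?_
  · linarith
  · intro a b h
    rw [hcomb] at h
    obtain ⟨v, w, hvw⟩ := hf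
    have h1 : ∀ v, a + b * f v = 0 := fun v => by
      simpa [hs0 v] using congrFun h v
    have hb : b = 0 := by
      have : b * (f v - f w) = 0 := by linarith [h1 v, h1 w]
      exact (mul_eq_zero.mp this).resolve_right (sub_ne_zero.mpr hvw)
    exact ⟨by simpa [hb] using h1 v, hb⟩
  · intro a b
    rw [hcomb]
    set h : V → ℝ := fun v => a + b * f v with hh
    have e1 : (s * h) ⬝ᵥ (s * h) = ∑ v, (G.degree v : ℝ) * h v ^ 2 := by
      simp only [dotProduct, Pi.mul_apply]
      exact Finset.sum_congr rfl fun v _ => by rw [← hss v]; ring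
    have e2 : (s * h) ⬝ᵥ S *ᵥ (s * h) = ∑ v, ∑ w, if G.Adj v w then h v * h w else 0 := by
      simp only [dotProduct, mulVec, Pi.mul_apply, Finset.mul_sum]
      refine Finset.sum_congr rfl fun v _ => Finset.sum_congr rfl fun w _ => ?_
      simp only [hSdef, diagonal_mul, mul_diagonal, SimpleGraph.adjMatrix_apply, Pi.inv_apply]
      split_ifs
      · have := hs0 v; have := hs0 w; field_simp
      · simp
    have e3 : ∑ v, ∑ w, (if G.Adj v w then (h v - h w) ^ 2 else 0) =
        2 * (∑ v, (G.degree v : ℝ) * h v ^ 2) -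
          2 * ∑ v, ∑ w, if G.Adj v w then h v * h w else 0 := by
      have r1 : ∀ v, ∑ w, (if G.Adj v w then h v ^ 2 else 0) = (G.degree v : ℝ) * h v ^ 2 := by
        intro v
        rw [← Finset.sum_filter, Finset.sum_const, nsmul_eq_mul, ← G.neighborFinset_eq_filter,
          G.card_neighborFinset_eq_degree]
      have r2 : ∑ v, ∑ w, (if G.Adj v w then h w ^ 2 else 0) =
          ∑ v, (G.degree v : ℝ) * h v ^ 2 := by
        rw [Finset.sum_comm]
        refine Finset.sum_congr rfl fun v _ => ?_
        rw [← r1]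
        simp only [G.adj_comm]
      rw [two_mul]
      nth_rewrite 2 [← r2]
      simp only [← r1, ← Finset.sum_add_distrib, Finset.mul_sum, ← Finset.sum_sub_distrib]
      refine Finset.sum_congr rfl fun v _ => Finset.sum_congr rfl fun w _ => ?_
      split_ifs <;> ring
    have e4 : ∑ v, ∑ w, (if G.Adj v w then (h v - h w) ^ 2 else 0) ≤
        2 * ε * ∑ v, (G.degree v : ℝ) * h v ^ 2 := by
      have e5 : ∑ v, ∑ w, (if G.Adj v w then (h v - h w) ^ 2 else 0) =
          b ^ 2 * ∑ v, ∑ w, (if G.Adj v w then (f v - f w) ^ 2 else 0) := by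
        simp only [Finset.mul_sum, mul_ite, mul_zero, hh]
        refine Finset.sum_congr rfl fun v _ => Finset.sum_congr rfl fun w _ => ?_
        split_ifs <;> ring
      rw [e5]
      by_cases hb : b = 0
      · rw [hb]
        simp only [ne_eq, OfNat.ofNat_ne_zero, not_false_eq_true, zero_pow, zero_mul]
        positivity
      · refine (mul_le_mul_of_nonneg_left (hE (a / b)) (sq_nonneg b)).trans_eq ?_
        simp only [Finset.mul_sum, hh]
        refine Finset.sum_congr rfl fun v _ => ?_
        field_simp
    rw [e1, e2]
    linarith

theorem SimpleGraph.card_le_degree_of_forall_adj {V α : Type*} (G : SimpleGraph V) (v : V)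
    [Fintype (G.neighborSet v)] (T : Finset α) (e : α ↪ V) (h : ∀ x ∈ T, G.Adj v (e x)) :
    T.card ≤ G.degree v := by
  rw [← Finset.card_map e]
  refine Finset.card_le_card fun w hw => ?_
  obtain ⟨x, hx, rfl⟩ := Finset.mem_map.mp hw
  exact (G.mem_neighborFinset v _).mpr (h x hx)

open Classical in
theorem dirichletEnergy_fromRel_le {V : Type*} [Fintype V] (R : V → V → Prop)
    (f : V → ℝ) :
    dirichletEnergy (SimpleGraph.fromRel R) f ≤
      2 * ∑ v, ∑ w, if R v w then (f v - f w) ^ 2 else 0 := by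
  rw [dirichletEnergy, two_mul]
  nth_rewrite 3 [Finset.sum_comm]
  simp only [← Finset.sum_add_distrib]
  refine Finset.sum_le_sum fun v _ => Finset.sum_le_sum fun w _ => ?_
  have h1 := sq_nonneg (f v - f w)
  have h2 := sq_nonneg (f w - f v)
  simp only [SimpleGraph.fromRel_adj]
  by_cases hvw : R v w <;> by_cases hwv : R w v <;> simp [hvw, hwv] <;> split_ifs <;> nlinarith

section Lollipop

variable {r m : ℕ}

theorem lollipop_adj_clique {a b : Fin r} (h : a ≠ b) :
    (lollipop r m).Adj (.inl (.inl a)) (.inl (.inl b)) := by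
  simp [lollipop, lollipopRel, h]

theorem lollipop_adj_clique_path {a i : Fin r} (ha : a.val = 0) (hi : i.val = 0) :
    (lollipop r m).Adj (.inl (.inl a)) (.inl (.inr i)) := by
  simp [lollipop, lollipopRel, ha, hi]

theorem lollipop_adj_path {i j : Fin r} (h : i.val + 1 = j.val) :
    (lollipop r m).Adj (.inl (.inr i)) (.inl (.inr j)) := by
  have : i ≠ j := by rintro rfl; omega
  simp [lollipop, lollipopRel, h, this]

theorem lollipop_adj_path_bipartite {i : Fin r} {b : Fin m} (hi : i.val = r - 1)
    (hb : b.val = 0) : (lollipop r m).Adj (.inl (.inr i)) (.inr (.inl b)) := by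
  simp [lollipop, lollipopRel, hi, hb]

theorem lollipop_adj_bipartite (b c : Fin m) :
    (lollipop r m).Adj (.inr (.inl b)) (.inr (.inr c)) := by
  simp [lollipop, lollipopRel]

theorem lollipop_compl_adj_clique (a : Fin r) (x : Fin m ⊕ Fin m) :
    (lollipop r m)ᶜ.Adj (.inl (.inl a)) (.inr x) := by
  simp [lollipop, lollipopRel]

theorem lollipop_compl_adj_inr_inr (x : Fin r ⊕ Fin r) (c : Fin m) :
    (lollipop r m)ᶜ.Adj (.inl x) (.inr (.inr c)) := by
  rcases x with a | i <;> simp [lollipop, lollipopRel]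

theorem lollipop_compl_adj_left {b c : Fin m} (h : b ≠ c) :
    (lollipop r m)ᶜ.Adj (.inr (.inl b)) (.inr (.inl c)) := by
  simp [lollipop, lollipopRel, h]

theorem lollipop_compl_adj_right {b c : Fin m} (h : b ≠ c) :
    (lollipop r m)ᶜ.Adj (.inr (.inr b)) (.inr (.inr c)) := by
  simp [lollipop, lollipopRel, h]

theorem lollipop_connected (hr : 0 < r) (hm : 0 < m) : (lollipop r m).Connected := by
  rw [SimpleGraph.connected_iff_exists_forall_reachable]
  have hpath : ∀ k (hk : k < r),
      (lollipop r m).Reachable (.inl (.inr ⟨0, hr⟩)) (.inl (.inr ⟨k, hk⟩)) := by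
    intro k
    induction k with
    | zero => exact fun _ => .rfl
    | succ k ih => exact fun hk => (ih (by omega)).trans (lollipop_adj_path rfl).reachable
  have hleft : (lollipop r m).Reachable (.inl (.inr ⟨0, hr⟩)) (.inr (.inl ⟨0, hm⟩)) :=
    (hpath (r - 1) (by omega)).trans (lollipop_adj_path_bipartite rfl rfl).reachable
  have hright : ∀ c, (lollipop r m).Reachable (.inl (.inr ⟨0, hr⟩)) (.inr (.inr c)) :=
    fun c => hleft.trans (lollipop_adj_bipartite _ c).reachable
  have hclique : (lollipop r m).Reachable (.inl (.inr ⟨0, hr⟩)) (.inl (.inl ⟨0, hr⟩)) :=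
    (lollipop_adj_clique_path rfl rfl).symm.reachable
  refine ⟨.inl (.inr ⟨0, hr⟩), ?_⟩
  rintro ((a | i) | (b | c))
  · by_cases ha : ⟨0, hr⟩ = a
    · exact ha ▸ hclique
    · exact hclique.trans (lollipop_adj_clique ha).reachable
  · exact hpath i i.2
  · exact (hright ⟨0, hm⟩).trans (lollipop_adj_bipartite b _).symm.reachable
  · exact hright c

theorem lollipop_compl_connected (hr : 0 < r) (hm : 0 < m) :
    ((lollipop r m)ᶜ).Connected := by
  rw [SimpleGraph.connected_iff_exists_forall_reachable]
  refine ⟨.inr (.inr ⟨0, hm⟩), ?_⟩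
  have hinl : ∀ x, (lollipop r m)ᶜ.Reachable (.inr (.inr ⟨0, hm⟩)) (.inl x) :=
    fun x => (lollipop_compl_adj_inr_inr x _).symm.reachable
  rintro (x | x)
  · exact hinl x
  · exact (hinl (.inl ⟨0, hr⟩)).trans (lollipop_compl_adj_clique _ x).reachable

theorem sub_one_le_degree_clique (a : Fin r)
    [Fintype ((lollipop r m).neighborSet (.inl (.inl a)))] :
    (r : ℝ) - 1 ≤ (lollipop r m).degree (.inl (.inl a)) := by
  have := (lollipop r m).card_le_degree_of_forall_adj (.inl (.inl a)) (Finset.univ.erase a)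
    (Function.Embedding.inl.trans Function.Embedding.inl)
    fun x hx => lollipop_adj_clique (Finset.ne_of_mem_erase hx).symm
  rw [Finset.card_erase_of_mem (Finset.mem_univ a), Finset.card_univ, Fintype.card_fin] at this
  rw [sub_le_iff_le_add]
  exact_mod_cast Nat.sub_le_iff_le_add.mp this

theorem le_degree_left (b : Fin m)
    [Fintype ((lollipop r m).neighborSet (.inr (.inl b)))] :
    (m : ℝ) ≤ (lollipop r m).degree (.inr (.inl b)) := by
  have := (lollipop r m).card_le_degree_of_forall_adj (.inr (.inl b)) Finset.univ
    (Function.Embedding.inr.trans Function.Embedding.inr) fun x _ => lollipop_adj_bipartite b x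
  rw [Finset.card_univ, Fintype.card_fin] at this
  exact_mod_cast this

theorem sub_one_le_compl_degree_left (b : Fin m)
    [Fintype ((lollipop r m)ᶜ.neighborSet (.inr (.inl b)))] :
    (m : ℝ) - 1 ≤ (lollipop r m)ᶜ.degree (.inr (.inl b)) := by
  have := (lollipop r m)ᶜ.card_le_degree_of_forall_adj (.inr (.inl b)) (Finset.univ.erase b)
    (Function.Embedding.inl.trans Function.Embedding.inr)
    fun x hx => lollipop_compl_adj_left (Finset.ne_of_mem_erase hx).symm
  rw [Finset.card_erase_of_mem (Finset.mem_univ b), Finset.card_univ, Fintype.card_fin] at this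
  rw [sub_le_iff_le_add]
  exact_mod_cast Nat.sub_le_iff_le_add.mp this

theorem sub_one_le_compl_degree_right (b : Fin m)
    [Fintype ((lollipop r m)ᶜ.neighborSet (.inr (.inr b)))] :
    (m : ℝ) - 1 ≤ (lollipop r m)ᶜ.degree (.inr (.inr b)) := by
  have := (lollipop r m)ᶜ.card_le_degree_of_forall_adj (.inr (.inr b)) (Finset.univ.erase b)
    (Function.Embedding.inr.trans Function.Embedding.inr)
    fun x hx => lollipop_compl_adj_right (Finset.ne_of_mem_erase hx).symm
  rw [Finset.card_erase_of_mem (Finset.mem_univ b), Finset.card_univ, Fintype.card_fin] at this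
  rw [sub_le_iff_le_add]
  exact_mod_cast Nat.sub_le_iff_le_add.mp this

theorem Fin.card_mul_le_sum {n : ℕ} (g : Fin n → ℝ) (c : ℝ) (h : ∀ i, c ≤ g i) :
    n * c ≤ ∑ i, g i := by
  simpa using Finset.card_nsmul_le_sum Finset.univ g c fun i _ => h i

theorem Fin.sum_le_card_mul {n : ℕ} (g : Fin n → ℝ) (c : ℝ) (h : ∀ i, g i ≤ c) :
    ∑ i, g i ≤ n * c := by
  simpa using Finset.sum_le_card_nsmul Finset.univ g c fun i _ => h i

theorem Fin.sum_ite_le {n : ℕ} (p : Fin n → Prop) [DecidablePred p] (g : Fin n → ℝ) (c : ℝ)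
    (hp : ∀ i j, p i → p j → i = j) (hc : 0 ≤ c) (h : ∀ i, p i → g i ≤ c) :
    (∑ i, if p i then g i else 0) ≤ c := by
  by_cases hex : ∃ i, p i
  · obtain ⟨i, hi⟩ := hex
    rw [Finset.sum_eq_single i (fun j _ hj => if_neg fun h => hj (hp j i h hi)) (by simp),
      if_pos hi]
    exact h i hi
  · push Not at hex
    simpa [hex] using hc

/-- Test function for the lollipop: harmonic along the path, constant on both of its ends. -/
def lollipopPotential (r m : ℕ) : (Fin r ⊕ Fin r) ⊕ (Fin m ⊕ Fin m) → ℝ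
  | .inl (.inl _) => r
  | .inl (.inr i) => r - 1 - i.val
  | .inr _ => 0

theorem dirichletEnergy_lollipopPotential_le (hr : 0 < r) :
    dirichletEnergy (lollipop r m) (lollipopPotential r m) ≤ 2 * ((r : ℝ) + 1) := by
  refine (dirichletEnergy_fromRel_le _ _).trans ?_
  refine mul_le_mul_of_nonneg_left ?_ zero_le_two
  simp only [Fintype.sum_sum_type, lollipopRel, lollipopPotential, ↓reduceIte, sub_self,
    ne_eq, OfNat.ofNat_ne_zero, not_false_eq_true, zero_pow, Finset.sum_const_zero, zero_add,
    add_zero, sub_zero, Finset.sum_add_distrib]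
  have h1 : (∑ a : Fin r, ∑ i : Fin r, if a.val = 0 ∧ i.val = 0 then
      ((r : ℝ) - (r - 1 - i.val)) ^ 2 else 0) ≤ 1 := by
    refine (Finset.sum_le_sum (g := fun a : Fin r => if a.val = 0 then (1 : ℝ) else 0)
      fun a _ => ?_).trans (Fin.sum_ite_le (fun a : Fin r => a.val = 0) _ _
        (fun i j hi hj => Fin.ext (hi.trans hj.symm)) zero_le_one fun _ _ => le_rfl)
    by_cases ha : a.val = 0
    · simp only [ha, true_and, if_true]
      refine Fin.sum_ite_le (fun i : Fin r => i.val = 0) _ _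
        (fun i j hi hj => Fin.ext (hi.trans hj.symm)) zero_le_one fun i hi => ?_
      rw [hi]; norm_num
    · simp [ha]
  have h2 : (∑ i : Fin r, ∑ j : Fin r, if i.val + 1 = j.val then
      ((r : ℝ) - 1 - i.val - (r - 1 - j.val)) ^ 2 else 0) ≤ (r : ℝ) := by
    refine (Fin.sum_le_card_mul _ 1 fun i => ?_).trans_eq (mul_one _)
    refine Fin.sum_ite_le (fun j : Fin r => i.val + 1 = j.val) _ _
      (fun j k hj hk => Fin.ext (hj.symm.trans hk)) zero_le_one fun j hj => ?_
    rw [← hj]; push_cast; ring_nf; rfl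
  have h3 : (∑ i : Fin r, ∑ b : Fin m, if i.val = r - 1 ∧ b.val = 0 then
      ((r : ℝ) - 1 - i.val) ^ 2 else 0) = 0 := by
    refine Finset.sum_eq_zero fun i _ => Finset.sum_eq_zero fun b _ => ?_
    split_ifs with h
    · rw [h.1, Nat.cast_sub hr]; simp
    · rfl
  have h4 := add_le_add (add_le_add h1 h2) h3.le
  rw [add_zero, add_comm 1] at h4
  convert h4 <;> split_ifs <;> simp [*]

open Classical in
theorem le_degreeNormSq_lollipopPotential (hr : 0 < r) (hm : (r : ℝ) * (r - 1) ≤ (m : ℝ) * m)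
    (a : ℝ) : (r : ℝ) ^ 3 * (r - 1) / 2 ≤
      degreeNormSq (lollipop r m) fun v => a + lollipopPotential r m v := by
  simp only [degreeNormSq, Fintype.sum_sum_type, lollipopPotential, add_zero]
  have h1 := Fin.card_mul_le_sum
    (fun x : Fin r => ((lollipop r m).degree (.inl (.inl x)) : ℝ) * (a + r) ^ 2) _
    fun x => mul_le_mul_of_nonneg_right (sub_one_le_degree_clique x) (sq_nonneg _)
  have h2 : 0 ≤ ∑ i : Fin r,
      ((lollipop r m).degree (.inl (.inr i)) : ℝ) * (a + (r - 1 - i.val)) ^ 2 := by positivity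
  have h3 := Fin.card_mul_le_sum
    (fun b : Fin m => ((lollipop r m).degree (.inr (.inl b)) : ℝ) * a ^ 2) _
    fun b => mul_le_mul_of_nonneg_right (le_degree_left b) (sq_nonneg _)
  have h4 : 0 ≤ ∑ b : Fin m, ((lollipop r m).degree (.inr (.inr b)) : ℝ) * a ^ 2 := by positivity
  have h5 := mul_le_mul_of_nonneg_right hm (sq_nonneg a)
  have hr' : (1 : ℝ) ≤ r := by exact_mod_cast hr
  have h6 : 0 ≤ (r : ℝ) * (r - 1) * (2 * a + r) ^ 2 :=
    mul_nonneg (mul_nonneg (by linarith) (by linarith)) (sq_nonneg _)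
  nlinarith

theorem spectralGap_lollipop_le (hr : 5 ≤ r) (hm : r ≤ m) :
    spectralGap (lollipop r m) ≤ 3 / (r : ℝ) ^ 3 := by
  have hr' : (5 : ℝ) ≤ r := by exact_mod_cast hr
  have hm' : (r : ℝ) ≤ m := by exact_mod_cast hm
  have : Nonempty (Fin r) := ⟨⟨0, by omega⟩⟩
  refine spectralGap_le_of_dirichlet _ (lollipopPotential r m) _ (by positivity)
    ⟨.inl (.inl ⟨0, by omega⟩), .inr (.inl ⟨0, by omega⟩), ?_⟩ fun a => ?_
  · simp only [lollipopPotential]; positivity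
  · refine (dirichletEnergy_lollipopPotential_le (by omega)).trans ?_
    refine le_trans ?_ (mul_le_mul_of_nonneg_left
      (le_degreeNormSq_lollipopPotential (by omega) (by nlinarith) a) (by positivity))
    have : 2 * (3 / (r : ℝ) ^ 3) * ((r : ℝ) ^ 3 * (r - 1) / 2) = 3 * (r - 1) := by
      field_simp
    rw [this]; linarith

/-- Test function for the complement: `±1` on the two cliques of `K_{m,m}ᶜ`, `0` elsewhere. -/
def bipartitionSign (r m : ℕ) : (Fin r ⊕ Fin r) ⊕ (Fin m ⊕ Fin m) → ℝ
  | .inl _ => 0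
  | .inr (.inl _) => 1
  | .inr (.inr _) => -1

theorem dirichletEnergy_bipartitionSign_le :
    dirichletEnergy (lollipop r m)ᶜ (bipartitionSign r m) ≤ 8 * (r : ℝ) * m := by
  refine le_trans (Finset.sum_le_sum
    (g := fun v => ∑ w, if v.isLeft = w.isLeft then (0 : ℝ) else 1)
    fun v _ => Finset.sum_le_sum fun w _ => ?_) (le_of_eq ?_)
  · rcases v with v | v | v <;> rcases w with w | w | w <;>
      simp [bipartitionSign, SimpleGraph.compl_adj, lollipop_adj_bipartite,
        (lollipop_adj_bipartite _ _).symm] <;> split_ifs <;> norm_num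
  · simp [Fintype.sum_sum_type]
    ring

open Classical in
theorem le_degreeNormSq_bipartitionSign (G : SimpleGraph ((Fin r ⊕ Fin r) ⊕ (Fin m ⊕ Fin m)))
    {c : ℝ} (hc : 0 ≤ c)
    (hleft : ∀ b [Fintype (G.neighborSet (.inr (.inl b)))],
      c ≤ G.degree (.inr (.inl b)))
    (hright : ∀ b [Fintype (G.neighborSet (.inr (.inr b)))],
      c ≤ G.degree (.inr (.inr b))) (a : ℝ) :
    2 * (m : ℝ) * c ≤ degreeNormSq G fun v => a + bipartitionSign r m v := by
  rw [degreeNormSq, Fintype.sum_sum_type, Fintype.sum_sum_type (α₁ := Fin m)]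
  simp only [bipartitionSign]
  have h1 : 0 ≤ ∑ x : Fin r ⊕ Fin r, (G.degree (.inl x) : ℝ) * (a + 0) ^ 2 := by positivity
  have h2 := Fin.card_mul_le_sum
    (fun b : Fin m => (G.degree (.inr (.inl b)) : ℝ) * (a + 1) ^ 2) _
    fun b => mul_le_mul_of_nonneg_right (hleft b) (sq_nonneg _)
  have h3 := Fin.card_mul_le_sum
    (fun b : Fin m => (G.degree (.inr (.inr b)) : ℝ) * (a + -1) ^ 2) _
    fun b => mul_le_mul_of_nonneg_right (hright b) (sq_nonneg _)
  have h4 : 0 ≤ (m : ℝ) * c * a ^ 2 := by positivity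
  nlinarith

theorem spectralGap_lollipop_compl_le (hm : 2 ≤ m) :
    spectralGap (lollipop r m)ᶜ ≤ 2 * r / ((m : ℝ) - 1) := by
  have hm' : (2 : ℝ) ≤ m := by exact_mod_cast hm
  have h1 : (0 : ℝ) < m - 1 := by linarith
  have : Nonempty (Fin m) := ⟨⟨0, by omega⟩⟩
  refine spectralGap_le_of_dirichlet _ (bipartitionSign r m) _ (by positivity)
    ⟨.inr (.inl ⟨0, by omega⟩), .inr (.inr ⟨0, by omega⟩), ?_⟩ fun a => ?_
  · simp only [bipartitionSign]; norm_num
  · refine dirichletEnergy_bipartitionSign_le.trans ?_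
    refine le_trans (le_of_eq ?_) (mul_le_mul_of_nonneg_left
      (le_degreeNormSq_bipartitionSign _ h1.le
        (fun b _ => sub_one_le_compl_degree_left b)
        (fun b _ => sub_one_le_compl_degree_right b) a) (by positivity))
    field_simp
    ring

end Lollipop

/-- **Counterexample to Conjecture 1.2.** For every `r ≥ 6`, the graph
`G = G_{r,r⁴}` on `n = 2r + 2r⁴` vertices and its complement are both connected, and
`Gap(G) + Gap(Ḡ) ≤ 8/r³ < 2/√n`. -/
theorem conjecture_two_counterexample (r : ℕ) (hr : 6 ≤ r) :
    (lollipop r (r ^ 4)).Connected ∧ ((lollipop r (r ^ 4))ᶜ).Connected ∧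
      spectralGap (lollipop r (r ^ 4)) + spectralGap (lollipop r (r ^ 4))ᶜ ≤
        8 / (r : ℝ) ^ 3 ∧
      8 / (r : ℝ) ^ 3 < 2 / Real.sqrt (2 * (r : ℝ) + 2 * (r : ℝ) ^ 4) := by
  have hr' : (6 : ℝ) ≤ r := by exact_mod_cast hr
  have hm : r ≤ r ^ 4 := Nat.le_self_pow (by norm_num) r
  refine ⟨lollipop_connected (by omega) (by omega), lollipop_compl_connected (by omega) (by omega),
    ?_, ?_⟩
  · have h1 := spectralGap_lollipop_le (r := r) (m := r ^ 4) (by omega) hm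
    have h2 := spectralGap_lollipop_compl_le (r := r) (m := r ^ 4) (by omega)
    have h3 : 2 * (r : ℝ) / (((r ^ 4 : ℕ) : ℝ) - 1) ≤ 5 / (r : ℝ) ^ 3 := by
      have h4 : (1 : ℝ) * 6 ≤ (r : ℝ) ^ 4 := by
        exact_mod_cast (by omega : 1 * 6 ≤ r ^ 4)
      push_cast
      rw [div_le_div_iff₀ (by linarith) (by positivity)]
      nlinarith
    have h5 : 8 / (r : ℝ) ^ 3 = 3 / (r : ℝ) ^ 3 + 5 / (r : ℝ) ^ 3 := by ring
    linarith
  · have h6 : (6 : ℝ) ^ 3 ≤ (r : ℝ) ^ 3 := by gcongr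
    have h1 : Real.sqrt (2 * (r : ℝ) + 2 * (r : ℝ) ^ 4) < (r : ℝ) ^ 3 / 4 := by
      rw [Real.sqrt_lt' (by positivity)]
      nlinarith [mul_nonneg (sub_nonneg.mpr hr') (by positivity : (0 : ℝ) ≤ (r : ℝ) ^ 5),
        mul_nonneg (sub_nonneg.mpr hr') (by positivity : (0 : ℝ) ≤ (r : ℝ) ^ 4),
        mul_nonneg (sub_nonneg.mpr h6) (by positivity : (0 : ℝ) ≤ (r : ℝ))]
    have h0 : 0 < Real.sqrt (2 * (r : ℝ) + 2 * (r : ℝ) ^ 4) := by positivity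
    rw [div_lt_div_iff₀ (by positivity) h0]
    linarith
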